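/- Consider a finite set of agents V partitioned into leaders V₀ and followers, with a layer function ℓ : V → ℕ such that ℓ(i) = 0 exactly for i ∈ V₀, and for each follower i a finite nonempty mentor set N_i ⊆ V with ℓ(j) < ℓ(i) for all j ∈ N_i. Fix t_f > 0, constant target positions p_i ∈ ℝ³ for all i ∈ V, continuous weight functions w_{i,j} : ℝ → ℝ for each follower i and j ∈ N_i with w_{i,j}(t) ≥ 0 and Σ_{j∈N_i} w_{i,j}(t) = 1 for all t, and w_{i,j}(t) = ϖ_{i,j} constant for all t ≥ t_f, where the final weights satisfy the consistency condition p_i = Σ_{j∈N_i} ϖ_{i,j}·p_j for every follower i. For each agent i let z_i : ℝ → ℝ^{12} be differentiable and satisfy z_i′(t) = (A − B·K_i)·z_i(t) + B·G_i·r_{i,d}(t), where A ∈ ℝ^{12×12}, B ∈ ℝ^{12×3}, C ∈ ℝ^{3×12} are fixed matrices with r_i(t) := C·z_i(t), each A − B·K_i is Hurwitz, each G_i ∈ ℝ^{3×3}, the reference is r_{i,d}(t) = p_i for i ∈ V₀ and r_{i,d}(t) = Σ_{j∈N_i} w_{i,j}(t)·r_j(t) for followers, and for every i the unique solution of (A −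 B·K_i)·z + B·G_i·q = 0 has C·z = q for each q ∈ ℝ³. Then r_i(t) → p_i as t → ∞ for every agent i ∈ V. -/

import Mathlib

open Matrix Filter Finset

/-- A solution of `f' = μ f + g` with `Re μ < 0` and `g → 0` converges to zero. -/
theorem tendsto_zero_of_hasDerivAt_smul_add {E : Type*} [NormedAddCommGroup E] [NormedSpace ℂ E]
    {μ : ℂ} (hμ : μ.re < 0) {f g : ℝ → E}
    (hf : ∀ t, HasDerivAt f (μ • f t + g t) t) (hg : Tendsto g atTop (nhds 0)) :
    Tendsto f atTop (nhds 0) := by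
  obtain ⟨a, ha, hμa⟩ : ∃ a : ℝ, 0 < a ∧ μ.re = -a := ⟨-μ.re, by linarith, by ring⟩
  have hexp (t : ℝ) : HasDerivAt (fun s : ℝ => Complex.exp (-μ * s))
      (Complex.exp (-μ * t) * (-μ)) t := by
    have h1 : HasDerivAt (fun s : ℝ => -μ * (s : ℂ)) (-μ) t := by
      simpa using (Complex.ofRealCLM.hasDerivAt (x := t)).const_mul (-μ)
    exact h1.cexp
  have hnorm (t : ℝ) : ‖Complex.exp (-μ * t)‖ = Real.exp (a * t) := by
    simp [Complex.norm_exp, hμa]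
  have hh (t : ℝ) : HasDerivAt (fun s : ℝ => Complex.exp (-μ * s) • f s)
      (Complex.exp (-μ * t) • g t) t := by
    refine ((hexp t).smul (hf t)).congr_deriv ?_
    module
  have hbound {ε T : ℝ} (hε : ∀ t, T ≤ t → ‖g t‖ ≤ ε) (t : ℝ) (ht : T ≤ t) :
      ‖f t‖ ≤ Real.exp (-(a * (t - T))) * ‖f T‖ + ε / a := by
    have hε0 : 0 ≤ ε := (norm_nonneg _).trans (hε T le_rfl)
    have hB (s : ℝ) : HasDerivAt
        (fun s => Real.exp (a * T) * ‖f T‖ + ε / a * (Real.exp (a * s) - Real.exp (a * T)))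
        (ε * Real.exp (a * s)) s := by
      have h1 : HasDerivAt (fun s : ℝ => Real.exp (a * s)) (Real.exp (a * s) * a) s := by
        simpa using ((hasDerivAt_id s).const_mul a).exp
      refine (((h1.sub_const (Real.exp (a * T))).const_mul (ε / a)).const_add
        (Real.exp (a * T) * ‖f T‖)).congr_deriv ?_
      field_simp
    have key := image_norm_le_of_norm_deriv_right_le_deriv_boundary (a := T) (b := t)
      (f := fun s : ℝ => Complex.exp (-μ * s) • f s)
      (fun s _ => (hh s).continuousAt.continuousWithinAt)
      (fun s _ => (hh s).hasDerivWithinAt)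
      (by rw [norm_smul, hnorm, sub_self, mul_zero, add_zero]) hB
      (fun s hs => by
        rw [norm_smul, hnorm, mul_comm]
        gcongr
        exact hε s hs.1) ⟨ht, le_rfl⟩
    rw [norm_smul, hnorm] at key
    have hpos := Real.exp_pos (a * t)
    have hsplit : Real.exp (-(a * (t - T))) = Real.exp (a * T) / Real.exp (a * t) := by
      rw [← Real.exp_sub]
      congr 1
      ring
    have hdiv : 0 ≤ ε / a * Real.exp (a * T) := by positivity
    rw [hsplit, ← mul_le_mul_iff_right₀ hpos]
    calc Real.exp (a * t) * ‖f t‖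
        ≤ Real.exp (a * T) * ‖f T‖ + ε / a * Real.exp (a * t) := by linarith
      _ = Real.exp (a * t) * (Real.exp (a * T) / Real.exp (a * t) * ‖f T‖ + ε / a) := by
        field_simp
  rw [Metric.tendsto_atTop] at hg ⊢
  intro δ hδ
  obtain ⟨T, hT⟩ := hg (a * δ / 2) (by positivity)
  have hlim : Tendsto (fun t => Real.exp (-(a * (t - T))) * ‖f T‖) atTop (nhds 0) := by
    have h1 : Tendsto (fun t => a * (t - T)) atTop atTop :=
      (tendsto_atTop_add_const_right _ (-T) tendsto_id).const_mul_atTop ha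
    simpa using (Real.tendsto_exp_neg_atTop_nhds_zero.comp h1).mul_const ‖f T‖
  obtain ⟨T', hT'⟩ := eventually_atTop.1 (hlim.eventually_lt_const (half_pos hδ))
  refine ⟨max T T', fun t ht => ?_⟩
  have h1 := hbound (ε := a * δ / 2) (fun s hs => by simpa using (hT s hs).le) t
    (le_of_max_le_left ht)
  have h2 := hT' t (le_of_max_le_right ht)
  have h3 : a * δ / 2 / a = δ / 2 := by field_simp
  rw [dist_zero_right]
  linarith

theorem Matrix.hasDerivAt_mulVec {𝕜 : Type*} [NontriviallyNormedField 𝕜] [NormedAlgebra ℝ 𝕜]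
    {m n : Type*} [Fintype m] [Fintype n] (M : Matrix m n 𝕜) {x : ℝ → n → 𝕜} {x' : n → 𝕜} {t : ℝ}
    (hx : HasDerivAt x x' t) : HasDerivAt (fun s => M *ᵥ x s) (M *ᵥ x') t := by
  rw [hasDerivAt_pi] at hx ⊢
  intro i
  simp only [mulVec, dotProduct]
  exact HasDerivAt.fun_sum fun j _ => (hx j).const_mul (M i j)

theorem Matrix.tendsto_mulVec {R : Type*} [NonUnitalNonAssocSemiring R] [TopologicalSpace R]
    [IsTopologicalSemiring R] {α m n : Type*} [Fintype n] {l : Filter α} (M : Matrix m n R)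
    {x : α → n → R} {y : n → R} (hx : Tendsto x l (nhds y)) :
    Tendsto (fun s => M *ᵥ x s) l (nhds (M *ᵥ y)) :=
  ((continuous_const.matrix_mulVec continuous_id).tendsto y).comp hx

open Polynomial in
theorem Matrix.tendsto_zero_of_tendsto_aeval_prod {n : Type*} [Fintype n] [DecidableEq n]
    (M : Matrix n n ℂ) {x u : ℝ → n → ℂ}
    (hx : ∀ t, HasDerivAt x (M *ᵥ x t + u t) t) (hu : Tendsto u atTop (nhds 0))
    (s : Multiset ℂ) (hs : ∀ μ ∈ s, μ.re < 0)
    (h : Tendsto (fun t => aeval M (s.map fun μ => X - Polynomial.C μ).prod *ᵥ x t)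
      atTop (nhds 0)) :
    Tendsto x atTop (nhds 0) := by
  induction s using Multiset.induction_on with
  | empty => simpa using h
  | cons μ s ih =>
    refine ih (fun ν hν => hs ν (Multiset.mem_cons_of_mem hν)) ?_
    set Q := aeval M (s.map fun μ => X - Polynomial.C μ).prod with hQ
    have hcomm : Q * M = M * Q := by
      have h1 := congrArg (aeval M) (mul_comm (s.map fun μ => X - Polynomial.C μ).prod X)
      rwa [map_mul, map_mul, aeval_X] at h1
    have hsum := h.add (Q.tendsto_mulVec hu)
    rw [mulVec_zero, add_zero] at hsum
    refine tendsto_zero_of_hasDerivAt_smul_add (hs μ (Multiset.mem_cons_self μ s))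
      (fun t => ?_) hsum
    refine (Q.hasDerivAt_mulVec (hx t)).congr_deriv ?_
    rw [Multiset.map_cons, Multiset.prod_cons, map_mul, ← hQ, mulVec_add, mulVec_mulVec, hcomm]
    simp only [map_sub, aeval_X, aeval_C, sub_mul, sub_mulVec, Algebra.algebraMap_eq_smul_one,
      smul_mul_assoc, one_mul, smul_mulVec]
    abel

/-- A solution of `x' = M x + u` with `M` Hurwitz and `u → 0` converges to zero. -/
theorem Matrix.tendsto_zero_of_hurwitz {n : Type*} [Fintype n] [DecidableEq n]
    (M : Matrix n n ℂ) (hM : ∀ μ ∈ spectrum ℂ M, μ.re < 0) {x u : ℝ → n → ℂ}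
    (hx : ∀ t, HasDerivAt x (M *ᵥ x t + u t) t) (hu : Tendsto u atTop (nhds 0)) :
    Tendsto x atTop (nhds 0) := by
  refine M.tendsto_zero_of_tendsto_aeval_prod hx hu M.charpoly.roots (fun μ hμ => hM μ ?_) ?_
  · exact Matrix.mem_spectrum_iff_isRoot_charpoly.2 (Polynomial.isRoot_of_mem_roots hμ)
  · rw [← (IsAlgClosed.splits M.charpoly).eq_prod_roots_of_monic M.charpoly_monic,
      aeval_self_charpoly]
    simp

theorem Matrix.tendsto_zero_of_hurwitz_real {n : Type*} [Fintype n] [DecidableEq n]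
    (M : Matrix n n ℝ) (hM : ∀ μ ∈ spectrum ℂ (M.map (algebraMap ℝ ℂ)), μ.re < 0)
    {x u : ℝ → n → ℝ} (hx : ∀ t, HasDerivAt x (M *ᵥ x t + u t) t)
    (hu : Tendsto u atTop (nhds 0)) : Tendsto x atTop (nhds 0) := by
  have key : Tendsto (fun t i => (x t i : ℂ)) atTop (nhds 0) := by
    refine tendsto_zero_of_hurwitz (M.map (algebraMap ℝ ℂ)) hM
      (u := fun t i => (u t i : ℂ)) (fun t => ?_) ?_
    · rw [hasDerivAt_pi]
      intro i
      refine (hasDerivAt_pi.1 (hx t) i).ofReal_comp.congr_deriv ?_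
      simp [mulVec, dotProduct]
    · rw [tendsto_pi_nhds] at hu ⊢
      intro i
      simpa [Function.comp_def] using (Complex.continuous_ofReal.tendsto 0).comp (hu i)
  rw [tendsto_pi_nhds] at key ⊢
  intro i
  simpa [Function.comp_def] using (Complex.continuous_re.tendsto 0).comp (key i)

theorem Matrix.isUnit_of_hurwitz {n : Type*} [Fintype n] [DecidableEq n]
    (M : Matrix n n ℝ) (hM : ∀ μ ∈ spectrum ℂ (M.map (algebraMap ℝ ℂ)), μ.re < 0) :
    IsUnit M := by
  have h : IsUnit (M.map (algebraMap ℝ ℂ)) := by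
    rw [← spectrum.zero_notMem_iff ℂ]
    exact fun h0 => by simpa using hM 0 h0
  rw [isUnit_iff_isUnit_det, isUnit_iff_ne_zero] at h ⊢
  intro hdet
  apply h
  rw [← RingHom.mapMatrix_apply, ← RingHom.map_det, hdet, map_zero]

/-- **Stability and convergence of the layered feed-forward DNN transport
dynamics.**  Leaders (layer 0) hold constant references `p i`; each follower
tracks a time-varying convex combination of its mentors' actual positions,
with mentors in strictly lower layers and weights that become the constant
final weights `ϖ` after the scheduling horizon `t_f` and are consistent with
the targets.  If every closed-loop matrix `A - B K i` is Hurwitz and the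
unique equilibrium of `(A - B K i) z + B G i q = 0` outputs `C z = q`, then
every agent's position `r i t = C (z i t)` converges to `p i`. -/
theorem stmt_15
    (V : Type*) [Fintype V] [DecidableEq V]
    (V₀ : Finset V)
    (ℓ : V → ℕ) (hℓ : ∀ i, ℓ i = 0 ↔ i ∈ V₀)
    (N : V → Finset V)
    (hNne : ∀ i ∉ V₀, (N i).Nonempty)
    (hNlt : ∀ i ∉ V₀, ∀ j ∈ N i, ℓ j < ℓ i)
    (t_f : ℝ) (ht_f : 0 < t_f)
    (p : V → (Fin 3 → ℝ))
    (w : V → V → ℝ → ℝ)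
    (hwcont : ∀ i ∉ V₀, ∀ j ∈ N i, Continuous (w i j))
    (hwnn : ∀ i ∉ V₀, ∀ j ∈ N i, ∀ t : ℝ, 0 ≤ w i j t)
    (hwsum : ∀ i ∉ V₀, ∀ t : ℝ, ∑ j ∈ N i, w i j t = 1)
    (ϖ : V → V → ℝ)
    (hwfin : ∀ i ∉ V₀, ∀ j ∈ N i, ∀ t : ℝ, t_f ≤ t → w i j t = ϖ i j)
    (hcons : ∀ i ∉ V₀, p i = ∑ j ∈ N i, ϖ i j • p j)
    (A : Matrix (Fin 12) (Fin 12) ℝ) (B : Matrix (Fin 12) (Fin 3) ℝ)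
    (C : Matrix (Fin 3) (Fin 12) ℝ)
    (K : V → Matrix (Fin 3) (Fin 12) ℝ) (G : V → Matrix (Fin 3) (Fin 3) ℝ)
    (hHurwitz : ∀ i : V,
      ∀ μ ∈ spectrum ℂ ((A - B * K i).map (algebraMap ℝ ℂ)), μ.re < 0)
    (z : V → ℝ → (Fin 12 → ℝ))
    (r : V → ℝ → (Fin 3 → ℝ)) (hr : ∀ i t, r i t = C.mulVec (z i t))
    (rd : V → ℝ → (Fin 3 → ℝ))
    (hrd0 : ∀ i ∈ V₀, ∀ t : ℝ, rd i t = p i)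
    (hrdf : ∀ i ∉ V₀, ∀ t : ℝ, rd i t = ∑ j ∈ N i, w i j t • r j t)
    (hz : ∀ i, Differentiable ℝ (z i))
    (hode : ∀ (i : V) (t : ℝ),
      deriv (z i) t =
        (A - B * K i).mulVec (z i t) + B.mulVec ((G i).mulVec (rd i t)))
    (heq : ∀ (i : V) (q : Fin 3 → ℝ) (zeq : Fin 12 → ℝ),
      (A - B * K i).mulVec zeq + B.mulVec ((G i).mulVec q) = 0 →
        C.mulVec zeq = q) :
    ∀ i : V, Tendsto (fun t => r i t) atTop (nhds (p i)) := by
  have step (i : V) (hrd : Tendsto (rd i) atTop (nhds (p i))) :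
      Tendsto (fun t => r i t) atTop (nhds (p i)) := by
    set M := A - B * K i with hM
    obtain ⟨zeq, hzeq⟩ : ∃ zeq, M *ᵥ zeq + B *ᵥ (G i *ᵥ p i) = 0 := by
      have hdet := (isUnit_iff_isUnit_det M).1 (M.isUnit_of_hurwitz (hHurwitz i))
      refine ⟨-(M⁻¹ *ᵥ (B *ᵥ (G i *ᵥ p i))), ?_⟩
      rw [mulVec_neg, mulVec_mulVec, mul_nonsing_inv M hdet, one_mulVec, neg_add_cancel]
    have hu : Tendsto (fun t => B *ᵥ (G i *ᵥ (rd i t - p i))) atTop (nhds 0) := by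
      simpa using B.tendsto_mulVec ((G i).tendsto_mulVec (hrd.sub_const (p i)))
    have hx : Tendsto (fun t => z i t - zeq) atTop (nhds 0) := by
      refine M.tendsto_zero_of_hurwitz_real (hHurwitz i) (fun t => ?_) hu
      refine ((hz i t).hasDerivAt.sub_const zeq).congr_deriv ?_
      rw [hode, ← hM, mulVec_sub, mulVec_sub, mulVec_sub, eq_neg_of_add_eq_zero_left hzeq]
      abel
    have hC := C.tendsto_mulVec (hx.add_const zeq)
    simpa only [sub_add_cancel, zero_add, heq i (p i) zeq hzeq, ← hr] using hC
  intro i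
  induction hn : ℓ i using Nat.strong_induction_on generalizing i with
  | _ n ih =>
    refine step i ?_
    by_cases hi : i ∈ V₀
    · simp only [funext (hrd0 i hi), tendsto_const_nhds]
    · rw [hcons i hi]
      have hlim : Tendsto (fun t => ∑ j ∈ N i, ϖ i j • r j t) atTop
          (nhds (∑ j ∈ N i, ϖ i j • p j)) :=
        tendsto_finsetSum _ fun j hj =>
          (ih (ℓ j) (hn ▸ hNlt i hi j hj) j rfl).const_smul (ϖ i j)
      refine hlim.congr' ?_
      filter_upwards [eventually_ge_atTop t_f] with t ht
      rw [hrdf i hi]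
      exact Finset.sum_congr rfl fun j hj => by rw [hwfin i hi j hj t ht]
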